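/- For every z ∈ ℝ^n and every x ∈ Π^B_{Ω_s}(z), one has ‖z − x‖² = ‖z‖² − ‖x‖², i.e. (1/2)·dist(z, Ω_s)² = (1/2)‖z‖² − (1/2)‖x‖². In particular, all elements of Π^B_{Ω_s}(z) have the same Euclidean norm. -/

import Mathlib

open scoped BigOperators

noncomputable section

/-- `Omega n s` is the set `Ω_s = {x ∈ ℝ^n : #{i : x_i > 0} ≤ s}`. -/
def Omega (n s : ℕ) : Set (EuclideanSpace ℝ (Fin n)) :=
  {x | (Finset.univ.filter fun i => 0 < x i).card ≤ s}

/-- `projSet n s z` is the set `Π^B_{Ω_s}(z)` of Euclidean projections of `z` onto `Ω_s`. -/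
def projSet (n s : ℕ) (z : EuclideanSpace ℝ (Fin n)) : Set (EuclideanSpace ℝ (Fin n)) :=
  {x | x ∈ Omega n s ∧ ‖z - x‖ = Metric.infDist z (Omega n s)}

theorem smul_mem_Omega {n s : ℕ} {x : EuclideanSpace ℝ (Fin n)} (hx : x ∈ Omega n s) {t : ℝ}
    (ht : 0 ≤ t) : t • x ∈ Omega n s := by
  refine (Finset.card_le_card (Finset.monotone_filter_right _ fun i _ hi => ?_)).trans hx
  rw [PiLp.smul_apply, smul_eq_mul] at hi
  exact pos_of_mul_pos_right hi ht

theorem inner_sub_eq_zero_of_mem_projSet {n s : ℕ} {z x : EuclideanSpace ℝ (Fin n)}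
    (hx : x ∈ projSet n s z) : inner ℝ (z - x) x = 0 := by
  set c := inner ℝ (z - x) x
  have scaled_le (e : ℝ) (he : -1 ≤ e) : 2 * e * c ≤ e ^ 2 * ‖x‖ ^ 2 := by
    have h : ‖z - x‖ ≤ ‖(z - x) - e • x‖ := by
      rw [hx.2]
      refine (Metric.infDist_le_dist_of_mem
        (smul_mem_Omega hx.1 (show 0 ≤ 1 + e by linarith))).trans_eq ?_
      rw [dist_eq_norm]
      congr 1
      module
    have h2 := pow_le_pow_left₀ (norm_nonneg _) h 2
    rw [norm_sub_sq_real (z - x), inner_smul_right, norm_smul, mul_pow, Real.norm_eq_abs,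
      sq_abs] at h2
    linarith
  have hD : 0 < ‖x‖ ^ 2 + |c| + 1 := by positivity
  have h := scaled_le (c / (‖x‖ ^ 2 + |c| + 1)) (by
    rw [le_div_iff₀ hD]
    linarith [neg_abs_le c, sq_nonneg ‖x‖])
  have h2 : 2 * c ^ 2 * (‖x‖ ^ 2 + |c| + 1) ≤ c ^ 2 * ‖x‖ ^ 2 := by
    have h3 := mul_le_mul_of_nonneg_right h (sq_nonneg (‖x‖ ^ 2 + |c| + 1))
    field_simp at h3
    linarith
  have h4 : c ^ 2 ≤ 0 := by
    nlinarith [mul_nonneg (sq_nonneg c) (sq_nonneg ‖x‖), mul_nonneg (sq_nonneg c) (abs_nonneg c),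
      sq_nonneg c]
  exact pow_eq_zero_iff two_ne_zero |>.1 (le_antisymm h4 (sq_nonneg c))

theorem norm_sub_sq_of_mem_projSet {n s : ℕ} {z x : EuclideanSpace ℝ (Fin n)}
    (hx : x ∈ projSet n s z) : ‖z - x‖ ^ 2 = ‖z‖ ^ 2 - ‖x‖ ^ 2 := by
  have h := norm_add_sq_real (z - x) x
  rw [sub_add_cancel, inner_sub_eq_zero_of_mem_projSet hx] at h
  linarith

/-- For every `z ∈ ℝ^n` and every `x ∈ Π^B_{Ω_s}(z)`: `‖z − x‖² = ‖z‖² − ‖x‖²`, i.e.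
`(1/2)·dist(z, Ω_s)² = (1/2)‖z‖² − (1/2)‖x‖²`; in particular all elements of `Π^B_{Ω_s}(z)`
have the same Euclidean norm. -/
theorem stmt_4 (n s : ℕ) (hn : 0 < n) (hs : 0 < s) (hsn : s ≤ n)
    (z x : EuclideanSpace ℝ (Fin n)) (hx : x ∈ projSet n s z) :
    ‖z - x‖ ^ 2 = ‖z‖ ^ 2 - ‖x‖ ^ 2 ∧
      (1 / 2) * Metric.infDist z (Omega n s) ^ 2 = (1 / 2) * ‖z‖ ^ 2 - (1 / 2) * ‖x‖ ^ 2 ∧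
      ∀ x' ∈ projSet n s z, ‖x'‖ = ‖x‖ := by
  have h := norm_sub_sq_of_mem_projSet hx
  refine ⟨h, ?_, fun x' hx' => ?_⟩
  · rw [← hx.2, h]
    ring
  · have h' := norm_sub_sq_of_mem_projSet hx'
    rw [hx'.2, ← hx.2] at h'
    exact (sq_eq_sq₀ (norm_nonneg _) (norm_nonneg _)).1 (by linarith)
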